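/- Every finite group G of odd order with α(G) = α(Z(G)) is abelian. -/

import Mathlib

/-- `α(G) = |C(G)| / |G|`, where `C(G)` is the set of cyclic subgroups of `G`. -/
noncomputable def alpha (G : Type*) [Group G] : ℚ :=
  (Nat.card {H : Subgroup G // IsCyclic H} : ℚ) / (Nat.card G : ℚ)

/-- For odd `e`, the function `n ↦ 1 / φ(n)` on divisors of `e` is a nonnegative combination of the
indicators of the divisors of `d`, for `d ∣ e`, with positive coefficient at `d = 1`. -/
theorem Nat.exists_inv_totient_eq_sum_divisors {e : ℕ} (he : Odd e) :
    ∃ c : ℕ → ℚ, (∀ d ∈ e.divisors, 0 ≤ c d) ∧ 0 < c 1 ∧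
      ∀ n, n ∣ e → (n.totient : ℚ)⁻¹ = ∑ d ∈ e.divisors, if n ∣ d then c d else 0 := by
  induction e using Nat.recOnPosPrimePosCoprime with
  | zero => simp at he
  | one => exact ⟨fun _ => 1, by simp, by simp, by simp⟩
  | prime_pow p k hp hk =>
    have hp2 : 2 < p := by
      have h1 : Odd p := he.of_dvd_nat (dvd_pow_self p hk.ne')
      have h2 := hp.two_le
      have h3 : p ≠ 2 := by rintro rfl; exact absurd h1 (by decide)
      omega
    set h : ℕ → ℚ := fun i => if i ≤ k then ((p ^ i).totient : ℚ)⁻¹ else 0 with hh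
    have hfac : ∀ i, (p ^ i).factorization p = i := fun i => by
      simp [hp.factorization_self]
    refine ⟨fun d => h (d.factorization p) - h (d.factorization p + 1), ?_, ?_, ?_⟩
    · intro d hd
      obtain ⟨i, hi, rfl⟩ := (Nat.mem_divisors_prime_pow hp k).1 hd
      simp only [hfac, sub_nonneg, hh, hi, if_true]
      split_ifs with h1
      · have h2 : 0 < (p ^ i).totient := Nat.totient_pos.2 (pow_pos hp.pos i)
        have h3 : 0 < (p ^ (i + 1)).totient := Nat.totient_pos.2 (pow_pos hp.pos _)
        gcongr
        exact Nat.le_of_dvd h3 (Nat.totient_dvd_of_dvd (pow_dvd_pow p (Nat.le_succ i)))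
      · positivity
    · have h1 : 1 ≤ k := hk
      have h2 : (1 : ℚ) < ((p - 1 : ℕ) : ℚ) := by exact_mod_cast (by omega : 1 < p - 1)
      simpa [hh, h1, Nat.totient_prime hp] using inv_lt_one_of_one_lt₀ h2
    · intro n hn
      obtain ⟨j, hj, rfl⟩ := (Nat.dvd_prime_pow hp).1 hn
      rw [Nat.sum_divisors_prime_pow hp]
      simp only [hfac, Nat.pow_dvd_pow_iff_le_right hp.one_lt]
      have h1 : (Finset.range (k + 1)).filter (j ≤ ·) = Finset.Ico j (k + 1) := by
        ext; simp; tauto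
      rw [← Finset.sum_filter, h1, ← neg_inj, ← Finset.sum_neg_distrib]
      simp only [neg_sub]
      rw [Finset.sum_Ico_sub h (by omega)]
      simp [hh, hj]
  | coprime a b ha hb hab iha ihb =>
    obtain ⟨c₁, h₁, h₁', h₁''⟩ := iha (he.of_dvd_nat (dvd_mul_right a b))
    obtain ⟨c₂, h₂, h₂', h₂''⟩ := ihb (he.of_dvd_nat (dvd_mul_left b a))
    have hgcd : ∀ x y, x ∣ a → y ∣ b → (x * y).gcd a = x ∧ (x * y).gcd b = y := by
      intro x y hx hy
      constructor
      · rw [(hab.symm.coprime_dvd_left hy).gcd_mul_right_cancel, Nat.gcd_eq_left hx]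
      · rw [(hab.coprime_dvd_left hx).gcd_mul_left_cancel, Nat.gcd_eq_left hy]
    have hprod : ∀ d, d ∣ a * b → d.gcd a * d.gcd b = d := fun d hd => by
      rw [← hab.gcd_mul, Nat.gcd_eq_left hd]
    refine ⟨fun d => c₁ (d.gcd a) * c₂ (d.gcd b), fun d _ => mul_nonneg
      (h₁ _ (by simp [Nat.gcd_dvd_right]; omega)) (h₂ _ (by simp [Nat.gcd_dvd_right]; omega)),
      by simpa using mul_pos h₁' h₂', fun n hn => ?_⟩
    have hcop : (n.gcd a).Coprime (n.gcd b) :=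
      (hab.coprime_dvd_left (Nat.gcd_dvd_right n a)).coprime_dvd_right (Nat.gcd_dvd_right n b)
    conv_lhs => rw [← hprod n hn, Nat.totient_mul hcop]
    rw [Nat.cast_mul, mul_inv, h₁'' _ (Nat.gcd_dvd_right n a), h₂'' _ (Nat.gcd_dvd_right n b),
      Finset.sum_mul_sum, ← Finset.sum_product']
    refine Finset.sum_nbij' (fun x => x.1 * x.2) (fun d => (d.gcd a, d.gcd b)) ?_ ?_ ?_ ?_ ?_
    · rintro ⟨x, y⟩ hx
      simp only [Finset.mem_product, Nat.mem_divisors] at hx ⊢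
      exact ⟨mul_dvd_mul hx.1.1 hx.2.1, mul_ne_zero hx.1.2 hx.2.2⟩
    · intro d hd
      simp [Nat.gcd_dvd_right]; omega
    · rintro ⟨x, y⟩ hx
      simp only [Finset.mem_product, Nat.mem_divisors] at hx
      simp [hgcd x y hx.1.1 hx.2.1]
    · intro d hd
      exact hprod d (Nat.dvd_of_mem_divisors hd)
    · rintro ⟨x, y⟩ hx
      simp only [Finset.mem_product, Nat.mem_divisors] at hx
      obtain ⟨hx1, hy1⟩ := hgcd x y hx.1.1 hx.2.1
      have key : n ∣ x * y ↔ n.gcd a ∣ x ∧ n.gcd b ∣ y := by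
        constructor
        · intro h
          constructor
          · rw [← hx1]; exact Nat.gcd_dvd_gcd_of_dvd_left a h
          · rw [← hy1]; exact Nat.gcd_dvd_gcd_of_dvd_left b h
        · rintro ⟨h, h'⟩
          rw [← hprod n hn]; exact mul_dvd_mul h h'
      simp only [hx1, hy1, key]
      by_cases h : n.gcd a ∣ x <;> by_cases h' : n.gcd b ∣ y <;> simp [h, h']

/-- A cyclic subgroup `H` is generated by exactly `φ(|H|)` elements. -/
theorem Subgroup.card_zpowers_eq {G : Type*} [Group G] [Fintype G] (H : Subgroup G) [IsCyclic H]
    [DecidablePred fun g : G => Subgroup.zpowers g = H] :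
    (Finset.univ.filter fun g : G => Subgroup.zpowers g = H).card = (Nat.card H).totient := by
  classical
  rw [← IsCyclic.card_orderOf_eq_totient (α := H) (d := Nat.card H)
    (by rw [Nat.card_eq_fintype_card])]
  symm
  refine Finset.card_bij (fun x _ => (x : G)) ?_ (fun _ _ _ _ h => Subtype.ext h) ?_
  · intro x hx
    simp only [Finset.mem_filter, Finset.mem_univ, true_and] at hx ⊢
    refine Subgroup.eq_of_le_of_card_ge (by simp) ?_
    rw [Nat.card_zpowers, Subgroup.orderOf_coe, hx]
  · intro g hg
    simp only [Finset.mem_filter, Finset.mem_univ, true_and] at hg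
    refine ⟨⟨g, hg ▸ Subgroup.mem_zpowers g⟩, ?_, rfl⟩
    simp only [Finset.mem_filter, Finset.mem_univ, true_and, Subgroup.orderOf_mk]
    rw [← hg, Nat.card_zpowers]

theorem card_isCyclic_eq_sum_inv_totient (G : Type*) [Group G] [Fintype G] :
    (Nat.card {H : Subgroup G // IsCyclic H} : ℚ) = ∑ g : G, ((orderOf g).totient : ℚ)⁻¹ := by
  classical
  have := Fintype.ofFinite {H : Subgroup G // IsCyclic H}
  rw [← Finset.sum_fiberwise_of_maps_to (t := Finset.univ)
    (g := fun g : G => (⟨Subgroup.zpowers g, inferInstance⟩ : {H : Subgroup G // IsCyclic H}))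
    (fun _ _ => Finset.mem_univ _), Nat.card_eq_fintype_card, ← Finset.card_univ,
    Finset.cast_card]
  refine Finset.sum_congr rfl fun H _ => ?_
  obtain ⟨H, hH⟩ := H
  simp only [Subtype.mk.injEq]
  rw [Finset.sum_congr rfl (g := fun _ => ((Nat.card H).totient : ℚ)⁻¹), Finset.sum_const,
    Subgroup.card_zpowers_eq, nsmul_eq_mul, mul_inv_cancel₀]
  · exact_mod_cast (Nat.totient_pos.2 Nat.card_pos).ne'
  · intro g hg
    simp only [Finset.mem_filter, Finset.mem_univ, true_and] at hg
    rw [← hg, Nat.card_zpowers]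

theorem sum_ite_orderOf_mul_dvd_le {G : Type*} [Group G] [Fintype G]
    [Fintype (Subgroup.center G)] (g : G) (d : ℕ) {c : ℚ} (hc : 0 ≤ c) :
    ∑ z : Subgroup.center G, (if orderOf (g * (z : G)) ∣ d then c else 0) ≤
      ∑ z : Subgroup.center G, if orderOf (z : G) ∣ d then c else 0 := by
  classical
  have hpow : ∀ z : Subgroup.center G, (g * (z : G)) ^ d = g ^ d * (z : G) ^ d := fun z =>
    Commute.mul_pow (Subgroup.mem_center_iff.1 z.2 g) d
  rw [← Finset.sum_filter, ← Finset.sum_filter, Finset.sum_const, Finset.sum_const]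
  simp only [orderOf_dvd_iff_pow_eq_one, hpow]
  refine nsmul_le_nsmul_left hc ?_
  rcases Finset.eq_empty_or_nonempty
    (Finset.univ.filter fun z : Subgroup.center G => g ^ d * (z : G) ^ d = 1) with h | ⟨w, hw⟩
  · simp [h]
  · refine Finset.card_le_card_of_injOn (fun z => w⁻¹ * z) ?_ (mul_right_injective _).injOn
    intro z hz
    simp only [Finset.coe_filter, Finset.mem_filter, Finset.mem_univ, true_and,
      Set.mem_ofPred_eq] at hw hz ⊢
    have h1 : w ^ d = z ^ d := by
      apply Subtype.ext
      simpa using mul_left_cancel (hw.trans hz.symm)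
    have h2 : (w⁻¹ * z) ^ d = 1 := by
      rw [Commute.mul_pow (Std.Commutative.comm _ _ : w⁻¹ * z = z * w⁻¹), inv_pow, h1,
        inv_mul_cancel]
    exact_mod_cast congrArg Subtype.val h2

theorem sum_inv_totient_orderOf_mul {G : Type*} [Group G] [Fintype G]
    [Fintype (Subgroup.center G)] (hodd : Odd (Nat.card G)) (g : G) :
    ∑ z : Subgroup.center G, ((orderOf (g * (z : G))).totient : ℚ)⁻¹ ≤
        ∑ z : Subgroup.center G, ((orderOf (z : G)).totient : ℚ)⁻¹ ∧
      (g ∉ Subgroup.center G →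
        ∑ z : Subgroup.center G, ((orderOf (g * (z : G))).totient : ℚ)⁻¹ <
          ∑ z : Subgroup.center G, ((orderOf (z : G)).totient : ℚ)⁻¹) := by
  obtain ⟨c, hc, hc1, hsum⟩ := Nat.exists_inv_totient_eq_sum_divisors hodd
  simp only [fun x : G => hsum _ (orderOf_dvd_natCard x)]
  rw [Finset.sum_comm, Finset.sum_comm (s := Finset.univ (α := Subgroup.center G))]
  have hle := fun d (hd : d ∈ (Nat.card G).divisors) =>
    sum_ite_orderOf_mul_dvd_le g d (hc d hd)
  refine ⟨Finset.sum_le_sum hle, fun hg => Finset.sum_lt_sum hle ⟨1, by simp, ?_⟩⟩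
  rw [Finset.sum_eq_zero]
  · refine Finset.sum_pos' (fun z _ => by split_ifs <;> simp [hc1.le]) ⟨1, by simp, by simpa⟩
  · intro z _
    rw [if_neg]
    rw [Nat.dvd_one, orderOf_eq_one_iff]
    intro h
    exact hg (eq_inv_of_mul_eq_one_left h ▸ inv_mem z.2)

/-- Every finite group of odd order with `α(G) = α(Z(G))` is abelian. -/
theorem comm_of_odd_alpha_eq (G : Type*) [Group G] [Finite G]
    (hodd : Odd (Nat.card G)) (h : alpha G = alpha (Subgroup.center G)) :
    ∀ x y : G, x * y = y * x := by
  classical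
  have := Fintype.ofFinite G
  rw [alpha, alpha, card_isCyclic_eq_sum_inv_totient, card_isCyclic_eq_sum_inv_totient,
    div_eq_div_iff (by exact_mod_cast Nat.card_pos.ne') (by exact_mod_cast Nat.card_pos.ne')] at h
  have hshift : (∑ g : G, ((orderOf g).totient : ℚ)⁻¹) * Nat.card (Subgroup.center G) =
      ∑ g : G, ∑ z : Subgroup.center G, ((orderOf (g * (z : G))).totient : ℚ)⁻¹ := by
    have hz : ∀ z : Subgroup.center G, ∑ g : G, ((orderOf (g * (z : G))).totient : ℚ)⁻¹ =
        ∑ g : G, ((orderOf g).totient : ℚ)⁻¹ := fun z =>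
      Equiv.sum_comp (Equiv.mulRight (z : G)) fun g => ((orderOf g).totient : ℚ)⁻¹
    rw [Finset.sum_comm]
    simp [hz, mul_comm]
  intro x y
  by_contra hxy
  refine h.not_lt ?_
  rw [hshift]
  calc _ < ∑ _g : G, ∑ z : Subgroup.center G, ((orderOf (z : G)).totient : ℚ)⁻¹ :=
        Finset.sum_lt_sum (fun g _ => (sum_inv_totient_orderOf_mul hodd g).1)
          ⟨y, Finset.mem_univ _, (sum_inv_totient_orderOf_mul hodd y).2 fun hy =>
            hxy (Subgroup.mem_center_iff.1 hy x)⟩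
    _ = _ := by simp only [Subgroup.orderOf_coe]; simp [mul_comm]
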